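/- The invariant K = −tr^G(a1^{p−1}) satisfies K = −tr^P(a3^{p−1}) − a0^{p−1}, and K ≡ (3ξ)^{(p−1)/2} + a1^{p−1} modulo the ideal generated by a0, where ξ = 3a2² − 4a3a1. In particular K ≠ 0 and its lead monomial in the graded reverse lexicographic order with a0 < a1 < a2 < a3 is a2^{p−1}. -/

import Mathlib

open MvPolynomial

noncomputable section

/-- The right action of the 2×2 matrix `g` over `F_p` on `F[V] = F[a₃,a₂,a₁,a₀]`
(with `aᵢ = X i`), given by the dual of the third symmetric power representation. -/
def act (p : ℕ) [Fact p.Prime] (F : Type) [Field F] [CharP F p]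
    (g : Matrix (Fin 2) (Fin 2) (ZMod p)) :
    MvPolynomial (Fin 4) F →ₐ[F] MvPolynomial (Fin 4) F :=
  letI c : ZMod p → MvPolynomial (Fin 4) F := fun x => C (ZMod.castHom (dvd_refl p) F x)
  letI al := c (g 0 0)
  letI be := c (g 0 1)
  letI ga := c (g 1 0)
  letI de := c (g 1 1)
  aeval ![
    de ^ 3 * X 0 + 3 * de ^ 2 * ga * X 1 + 3 * de * ga ^ 2 * X 2 + ga ^ 3 * X 3,
    de ^ 2 * be * X 0 + (de ^ 2 * al + 2 * de * be * ga) * X 1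
      + (2 * de * ga * al + be * ga ^ 2) * X 2 + ga ^ 2 * al * X 3,
    de * be ^ 2 * X 0 + (2 * de * be * al + be ^ 2 * ga) * X 1
      + (de * al ^ 2 + 2 * be * ga * al) * X 2 + ga * al ^ 2 * X 3,
    be ^ 3 * X 0 + 3 * be ^ 2 * al * X 1 + 3 * be * al ^ 2 * X 2 + al ^ 3 * X 3]

/-- The transfer with respect to the Sylow `p`-subgroup `P = ⟨σ⟩`,
`tr^P(f) = ∑_{τ ∈ P} (f)τ`, where the elements of `P` are the matrices `[[1,s],[0,1]]`. -/
def trP (p : ℕ) [Fact p.Prime] (F : Type) [Field F] [CharP F p]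
    (f : MvPolynomial (Fin 4) F) : MvPolynomial (Fin 4) F :=
  ∑ s : ZMod p, act p F !![1, s; 0, 1] f

/-- The relative transfer `tr_B^G(f) = ∑_{τ ∈ Q ∪ {η}} (f)τ`, using the coset
representatives `Q ∪ {η}` of the Borel subgroup `B` in `G = SL₂(F_p)`. -/
def trBG (p : ℕ) [Fact p.Prime] (F : Type) [Field F] [CharP F p]
    (f : MvPolynomial (Fin 4) F) : MvPolynomial (Fin 4) F :=
  (∑ s : ZMod p, act p F !![1, 0; s, 1] f) + act p F !![0, 1; -1, 0] f

/-- The full transfer `tr^G(f) = ∑_{τ ∈ SL₂(F_p)} (f)τ`. -/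
def trG (p : ℕ) [Fact p.Prime] (F : Type) [Field F] [CharP F p]
    (f : MvPolynomial (Fin 4) F) : MvPolynomial (Fin 4) F :=
  ∑ g : Matrix.SpecialLinearGroup (Fin 2) (ZMod p), act p F g.1 f

/-- `N = ∏_{τ ∈ P} (a₃)τ = ∏_{s ∈ F_p} (a₃ + 3s a₂ + 3s² a₁ + s³ a₀)`. -/
def Npoly (p : ℕ) [Fact p.Prime] (F : Type) [Field F] [CharP F p] :
    MvPolynomial (Fin 4) F :=
  ∏ s : ZMod p, act p F !![1, s; 0, 1] (X 3)

/-- The weight of the monomial `a₃^e₃ a₂^e₂ a₁^e₁ a₀^e₀`, i.e. `3e₃ + e₂ - e₁ - 3e₀`. -/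
def wt (d : Fin 4 →₀ ℕ) : ℤ :=
  3 * (d 3 : ℤ) + (d 2 : ℤ) - (d 1 : ℤ) - 3 * (d 0 : ℤ)

/-- `f` is isobaric of weight `lam` modulo `p - 1`: every monomial occurring in `f`
has weight congruent to `lam` modulo `p - 1`. -/
def Isobaric (p : ℕ) {F : Type} [Field F] (f : MvPolynomial (Fin 4) F) (lam : ℤ) : Prop :=
  ∀ d ∈ f.support, ((p : ℤ) - 1) ∣ (wt d - lam)

/-- Strict grevlex comparison on exponent vectors, for the graded reverse
lexicographic order with `a₀ < a₁ < a₂ < a₃`. -/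
def grevlexLt (d e : Fin 4 →₀ ℕ) : Prop :=
  (∑ i : Fin 4, d i) < (∑ i : Fin 4, e i) ∨
    ((∑ i : Fin 4, d i) = (∑ i : Fin 4, e i) ∧
      ∃ k : Fin 4, e k < d k ∧ ∀ j : Fin 4, j < k → d j = e j)

/-- `d` is the lead monomial of `f` in the grevlex order with `a₀ < a₁ < a₂ < a₃`. -/
def LeadMonomialIs {F : Type} [Field F] (f : MvPolynomial (Fin 4) F) (d : Fin 4 →₀ ℕ) : Prop :=
  coeff d f ≠ 0 ∧ ∀ e ∈ f.support, e ≠ d → grevlexLt e d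

/-- The lead term of `f` is `c · x^d` in the grevlex order with `a₀ < a₁ < a₂ < a₃`. -/
def LeadTermIs {F : Type} [Field F] (f : MvPolynomial (Fin 4) F) (c : F) (d : Fin 4 →₀ ℕ) :
    Prop :=
  LeadMonomialIs f d ∧ coeff d f = c

/-- The discriminant `D` of the binary cubic. -/
def Dpoly (F : Type) [Field F] : MvPolynomial (Fin 4) F :=
  3 * X 2 ^ 2 * X 1 ^ 2 - 4 * X 3 * X 1 ^ 3 - 4 * X 2 ^ 3 * X 0
    + 6 * X 3 * X 2 * X 1 * X 0 - X 3 ^ 2 * X 0 ^ 2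

/-- `K = -tr^G(a₁^{p-1})`. -/
def Kpoly (p : ℕ) [Fact p.Prime] (F : Type) [Field F] [CharP F p] :
    MvPolynomial (Fin 4) F :=
  - trG p F (X 1 ^ (p - 1))

/-- Dickson's invariant `L = 3(a₂^p a₁ - a₂ a₁^p) - (a₃^p a₀ - a₃ a₀^p)`. -/
def Lpoly (p : ℕ) (F : Type) [Field F] : MvPolynomial (Fin 4) F :=
  3 * (X 2 ^ p * X 1 - X 2 * X 1 ^ p) - (X 3 ^ p * X 0 - X 3 * X 0 ^ p)

/-- `e = 2a₁³ + a₀(a₃a₀ - 3a₂a₁)`. -/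
def epoly (F : Type) [Field F] : MvPolynomial (Fin 4) F :=
  2 * X 1 ^ 3 + X 0 * (X 3 * X 0 - 3 * X 2 * X 1)

/-- `d = a₁² - a₂a₀`. -/
def dpoly (F : Type) [Field F] : MvPolynomial (Fin 4) F :=
  X 1 ^ 2 - X 2 * X 0

/-- `ξ = 3a₂² - 4a₃a₁`. -/
def xipoly (F : Type) [Field F] : MvPolynomial (Fin 4) F :=
  3 * X 2 ^ 2 - 4 * X 3 * X 1

/-- The ring of `SL₂(F_p)`-invariants `F[V]^{SL₂(F_p)}`, as a subalgebra of `F[V]`. -/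
def invariants (p : ℕ) [Fact p.Prime] (F : Type) [Field F] [CharP F p] :
    Subalgebra F (MvPolynomial (Fin 4) F) where
  carrier := {f | ∀ g : Matrix.SpecialLinearGroup (Fin 2) (ZMod p), act p F g.1 f = f}
  mul_mem' := fun hf hg g => by rw [map_mul, hf g, hg g]
  one_mem' := fun g => map_one _
  add_mem' := fun hf hg g => by rw [map_add, hf g, hg g]
  zero_mem' := fun g => map_zero _
  algebraMap_mem' := fun c g => (act _ _ _).commutes c

section helpers

lemma sumpow {p : ℕ} [Fact p.Prime] {R : Type} [CommRing R] (φ : ZMod p →+* R) (i : ℕ) :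
    ∑ s : ZMod p, φ s ^ i = if i ≠ 0 ∧ (p - 1) ∣ i then -1 else 0 := by
  have key : ∑ s : ZMod p, s ^ i = if i ≠ 0 ∧ (p - 1) ∣ i then -1 else 0 := by
    by_cases hi : i = 0
    · simp [hi]
    · have h := FiniteField.sum_pow_units (ZMod p) i
      rw [ZMod.card] at h
      simp only [ne_eq, hi, not_false_eq_true, true_and]
      rw [← h]
      have h2 := Fintype.sum_eq_add_sum_subtype_ne (fun s : ZMod p => s ^ i) 0
      rw [h2]
      simp only [ne_eq, hi, not_false_eq_true, zero_pow, zero_add]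
      symm
      exact Fintype.sum_equiv unitsEquivNeZero _ _ (fun x => rfl)
  have := congrArg φ key
  rw [map_sum] at this
  simp only [map_pow] at this
  rw [this]
  split_ifs <;> simp

lemma sumlin {p : ℕ} [Fact p.Prime] {R : Type} [CommRing R] (φ : ZMod p →+* R) (a b : R) :
    ∑ t : ZMod p, (φ t * b + a) ^ (p - 1) = - b ^ (p - 1) := by
  have hp := (Fact.out : p.Prime).two_le
  simp only [add_pow]
  rw [Finset.sum_comm, Finset.sum_eq_single (p - 1)]
  · simp only [mul_pow, Nat.sub_self, pow_zero, mul_one, Nat.choose_self, Nat.cast_one]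
    rw [← Finset.sum_mul, sumpow, if_pos ⟨by omega, dvd_rfl⟩]
    ring
  · intro k hk hne
    have hk2 : k < p - 1 := by have := Finset.mem_range.1 hk; omega
    simp only [mul_pow]
    have : ∀ s : ZMod p, φ s ^ k * b ^ k * a ^ (p - 1 - k) * ((p - 1).choose k : R)
        = φ s ^ k * (b ^ k * a ^ (p - 1 - k) * ((p - 1).choose k : R)) := fun s => by ring
    simp only [this]
    rw [← Finset.sum_mul, sumpow, if_neg, zero_mul]
    rintro ⟨h0, hd⟩
    have := Nat.le_of_dvd (by omega) hd
    omega
  · intro h; simp at h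

lemma choose_pm {p : ℕ} [Fact p.Prime] (k : ℕ) (hk : k < p) :
    ((p - 1).choose k : ZMod p) = (-1) ^ k := by
  have hp := (Fact.out : p.Prime).two_le
  induction k with
  | zero => simp
  | succ k ih =>
    have h := Nat.choose_succ_succ (p - 1) k
    rw [show (p - 1).succ = p by omega] at h
    have h2 : ((p.choose (k + 1) : ℕ) : ZMod p) = 0 :=
      (ZMod.natCast_eq_zero_iff _ _).2
        ((Fact.out : p.Prime).dvd_choose_self (by omega) hk)
    rw [h] at h2
    push_cast at h2
    rw [ih (by omega)] at h2
    rw [pow_succ]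
    linear_combination h2

lemma choose_central {p : ℕ} [Fact p.Prime] (h : ℕ) (hh : p = 2 * h + 1) (k : ℕ) (hk : k ≤ h) :
    ((2 * k).choose k : ZMod p) = (-4) ^ k * (h.choose k : ZMod p) := by
  induction k with
  | zero => simp
  | succ k ih =>
    have h1 := congrArg (Nat.cast : ℕ → ZMod p) (Nat.succ_mul_centralBinom_succ k)
    have h2 := congrArg (Nat.cast : ℕ → ZMod p) (Nat.choose_succ_right_eq h k)
    simp only [Nat.centralBinom] at h1
    have ih := ih (by omega)
    push_cast [Nat.cast_sub (show k ≤ h by omega)] at h1 h2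
    rw [ih] at h1
    have h3 : (2 * h + 1 : ZMod p) = 0 := by
      have : ((2 * h + 1 : ℕ) : ZMod p) = 0 := by rw [← hh]; simp
      exact_mod_cast this
    have h4 : ((k : ZMod p) + 1) ≠ 0 := by
      intro h0
      have : ((k + 1 : ℕ) : ZMod p) = 0 := by exact_mod_cast h0
      rw [ZMod.natCast_eq_zero_iff] at this
      have := Nat.le_of_dvd (by omega) this
      omega
    apply mul_left_cancel₀ h4
    rw [h1, pow_succ]
    linear_combination (4 * (-4) ^ k) * h2 + (2 * (-4) ^ k * (h.choose k : ZMod p)) * h3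

lemma quad {p : ℕ} [Fact p.Prime] (h : ℕ) (hh : p = 2 * h + 1) {R : Type} [CommRing R]
    (φ : ZMod p →+* R) (A B D : R) :
    ∑ s : ZMod p, (A * φ s ^ 2 + B * φ s + D) ^ (p - 1)
      = - (B ^ 2 - 4 * A * D) ^ h - A ^ (p - 1) := by
  have hp := (Fact.out : p.Prime).two_le
  have e1 : ∀ s : ZMod p, (A * φ s ^ 2 + B * φ s + D) ^ (p - 1) =
      ∑ m ∈ Finset.range p, ∑ k ∈ Finset.range p,
        ((p - 1).choose m * m.choose k : R) * A ^ k * D ^ (m - k) * B ^ (p - 1 - m)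
          * φ s ^ (2 * k + (p - 1 - m)) := by
    intro s
    rw [show A * φ s ^ 2 + B * φ s + D = (A * φ s ^ 2 + D) + B * φ s by ring, add_pow,
      show p - 1 + 1 = p by omega]
    refine Finset.sum_congr rfl fun m hm => ?_
    have hm := Finset.mem_range.1 hm
    have e2 : (A * φ s ^ 2 + D) ^ m = ∑ k ∈ Finset.range p,
        (A * φ s ^ 2) ^ k * D ^ (m - k) * (m.choose k : R) := by
      rw [add_pow]
      refine Finset.sum_subset (fun k hk => ?_) (fun k _ hk => ?_)
      · simp at hk ⊢; omega
      · simp at hk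
        rw [Nat.choose_eq_zero_of_lt (by omega)]; simp
    rw [e2, Finset.sum_mul, Finset.sum_mul]
    refine Finset.sum_congr rfl fun k hk => ?_
    rw [mul_pow, mul_pow, pow_add, pow_mul]
    ring
  simp only [e1]
  rw [Finset.sum_comm]
  have e3 : ∀ m ∈ Finset.range p, ∑ s : ZMod p, ∑ k ∈ Finset.range p,
        ((p - 1).choose m * m.choose k : R) * A ^ k * D ^ (m - k) * B ^ (p - 1 - m)
          * φ s ^ (2 * k + (p - 1 - m)) =
      ∑ k ∈ Finset.range p, (
        (if m = 2 * k then
          - ((-4) ^ k * (h.choose k : R) * A ^ k * D ^ k * B ^ (2 * h - 2 * k)) else 0)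
        + (if m = p - 1 then (if k = p - 1 then - A ^ (p - 1) else 0) else 0)) := by
    intro m hm
    have hm := Finset.mem_range.1 hm
    rw [Finset.sum_comm]
    refine Finset.sum_congr rfl fun k hk => ?_
    have hk := Finset.mem_range.1 hk
    rw [← Finset.mul_sum, sumpow]
    by_cases hkm : m < k
    · have hm2 : ¬ m = 2 * k := by omega
      have hm1 : ¬ m = p - 1 := by omega
      rw [Nat.choose_eq_zero_of_lt hkm]
      simp [hm1, hm2]
    · by_cases h1 : m = 2 * k
      · rw [if_pos h1, if_pos ⟨by omega, by rw [show 2 * k + (p - 1 - m) = p - 1 by omega]⟩]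
        have e4 : (if m = p - 1 then (if k = p - 1 then - A ^ (p - 1) else 0) else 0) = 0 := by
          split_ifs
          · omega
          · rfl
          · rfl
        rw [e4]
        subst h1
        have c1 := congrArg φ (choose_pm (p := p) (2 * k) hm)
        have c2 := congrArg φ (choose_central (p := p) h hh k (by omega))
        simp only [map_natCast, map_pow, map_neg, map_one, map_mul, map_ofNat] at c1 c2
        rw [c1, c2, show 2 * k - k = k by omega, show p - 1 - 2 * k = 2 * h - 2 * k by omega]
        rw [pow_mul]
        simp
      · rw [if_neg h1]
        by_cases h2 : m = p - 1
        · by_cases h3 : k = p - 1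
          · rw [if_pos h2, if_pos h3, if_pos]
            · subst h3; rw [h2]; simp
            · refine ⟨by omega, ?_⟩
              rw [h2, h3]; simp
          · rw [if_pos h2, if_neg h3, if_neg, mul_zero, zero_add]
            rintro ⟨h4, c, h5⟩
            rw [h2] at h5
            rcases c with _ | _ | c
            · omega
            · omega
            · have : (p - 1) * (c + 1 + 1) = (p - 1) * c + 2 * (p - 1) := by ring
              have h6 : 0 ≤ (p - 1) * c := Nat.zero_le _
              omega
        · rw [if_neg h2, if_neg, mul_zero, zero_add]
          rintro ⟨h4, c, h5⟩
          rcases c with _ | _ | c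
          · omega
          · omega
          · have : (p - 1) * (c + 1 + 1) = (p - 1) * c + 2 * (p - 1) := by ring
            have h6 : 0 ≤ (p - 1) * c := Nat.zero_le _
            omega
  rw [Finset.sum_congr rfl e3]
  simp only [Finset.sum_add_distrib]
  have e5 : ∑ m ∈ Finset.range p, ∑ k ∈ Finset.range p,
      (if m = p - 1 then (if k = p - 1 then - A ^ (p - 1) else 0) else 0) = - A ^ (p - 1) := by
    rw [Finset.sum_eq_single (p - 1), Finset.sum_eq_single (p - 1)]
    · simp
    · intro k _ hk; simp [hk]
    · intro hk; simp at hk; omega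
    · intro k _ hk; simp [hk]
    · intro hk; simp at hk; omega
  rw [e5, Finset.sum_comm, sub_eq_add_neg]
  congr 1
  rw [sub_eq_neg_add, add_pow, ← Finset.sum_neg_distrib]
  symm
  have e6 : ∀ k ∈ Finset.range p, ∑ m ∈ Finset.range p, (if m = 2 * k then
          - ((-4) ^ k * (h.choose k : R) * A ^ k * D ^ k * B ^ (2 * h - 2 * k)) else 0) =
          if 2 * k < p then - ((-4) ^ k * (h.choose k : R) * A ^ k * D ^ k * B ^ (2 * h - 2 * k))
          else 0 := by
    intro k _
    rw [Finset.sum_ite_eq']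
    simp
  rw [Finset.sum_congr rfl e6]
  have e7 : ∀ k ∈ Finset.range (h + 1),
      -((-(4 * A * D)) ^ k * (B ^ 2) ^ (h - k) * (h.choose k : R)) =
       if 2 * k < p then - ((-4) ^ k * (h.choose k : R) * A ^ k * D ^ k * B ^ (2 * h - 2 * k))
          else 0 := by
    intro k hk
    have hk := Finset.mem_range.1 hk
    rw [if_pos (by omega), ← pow_mul, show 2 * (h - k) = 2 * h - 2 * k by omega,
      show -(4 * A * D) = (-4) * A * D by ring, mul_pow, mul_pow]
    ring
  rw [Finset.sum_congr rfl e7]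
  refine Finset.sum_subset (fun k hk => ?_) (fun k _ hk => ?_)
  · simp at hk ⊢; omega
  · simp at hk; rw [if_neg (by omega)]

/-- parametrisation of `SL₂(F_p)` by Bruhat cells. -/
def cell1 {p : ℕ} [Fact p.Prime] (x : (ZMod p)ˣ × ZMod p × ZMod p) :
    Matrix.SpecialLinearGroup (Fin 2) (ZMod p) :=
  ⟨!![x.2.2, x.2.2 * x.2.1 - (x.1⁻¹ : (ZMod p)ˣ); (x.1 : ZMod p), x.1 * x.2.1], by
    rw [Matrix.det_fin_two_of]
    have := x.1.inv_mul
    linear_combination this⟩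

def cell2 {p : ℕ} [Fact p.Prime] (x : (ZMod p)ˣ × ZMod p) :
    Matrix.SpecialLinearGroup (Fin 2) (ZMod p) :=
  ⟨!![(x.1⁻¹ : (ZMod p)ˣ), x.2; 0, (x.1 : ZMod p)], by
    rw [Matrix.det_fin_two_of]
    have := x.1.inv_mul
    linear_combination this⟩

lemma cells_bij {p : ℕ} [Fact p.Prime] :
    Function.Bijective (Sum.elim (cell1 (p := p)) (cell2 (p := p))) := by
  constructor
  · rintro (⟨u, s, t⟩ | ⟨u, t⟩) (⟨v, s2, t2⟩ | ⟨v, t2⟩) hx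
    all_goals
      have h00 := congrArg (fun g => g.1 0 0) hx
      have h01 := congrArg (fun g => g.1 0 1) hx
      have h10 := congrArg (fun g => g.1 1 0) hx
      have h11 := congrArg (fun g => g.1 1 1) hx
      simp [cell1, cell2, -Units.val_inv_eq_inv_val, -ZMod.inv_coe_unit] at h00 h01 h10 h11
    · have hu : u = v := Units.ext h10
      subst hu
      simp at h11
      simp [h11, h00]
    · exact absurd h10.symm v.ne_zero
    · simp [h01, Units.ext h11]
  · intro g
    have hd := Matrix.det_fin_two g.1
    rw [g.2] at hd
    by_cases h : g.1 1 0 = 0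
    · rw [h] at hd
      have h1 : g.1 1 1 ≠ 0 := by intro h1; rw [h1] at hd; simp at hd
      refine ⟨Sum.inr (Units.mk0 _ h1, g.1 0 1), ?_⟩
      apply Subtype.ext
      ext i j
      fin_cases i <;> fin_cases j <;> simp [cell2, h]
      field_simp
      linear_combination hd
    · refine ⟨Sum.inl (Units.mk0 _ h, g.1 1 1 / g.1 1 0, g.1 0 0), ?_⟩
      apply Subtype.ext
      ext i j
      fin_cases i <;> fin_cases j <;> simp [cell1]
      · field_simp
        linear_combination -hd
      · field_simp

variable (p : ℕ) [Fact p.Prime] (F : Type) [Field F] [CharP F p]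

/-- constants -/
def cc : ZMod p →+* MvPolynomial (Fin 4) F := C.comp (ZMod.castHom (dvd_refl p) F)

/-- `(a₃)σ^s` -/
def MM (s : ZMod p) : MvPolynomial (Fin 4) F :=
  cc p F s ^ 3 * X 0 + 3 * cc p F s ^ 2 * X 1 + 3 * cc p F s * X 2 + X 3

lemma ccu (u : (ZMod p)ˣ) : cc p F u ^ (p - 1) = 1 := by
  rw [← map_pow, ZMod.pow_card_sub_one_eq_one u.ne_zero, map_one]

lemma ccu2 (u : (ZMod p)ˣ) : (cc p F u ^ 2) ^ (p - 1) = 1 := by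
  rw [← pow_mul, mul_comm, pow_mul, ccu, one_pow]

lemma trP_eq : trP p F (X 3 ^ (p - 1)) = ∑ s : ZMod p, MM p F s ^ (p - 1) := by
  unfold trP
  refine Finset.sum_congr rfl fun s _ => ?_
  rw [map_pow]
  congr 1
  simp [act, MM, cc]

lemma act1 (g : Matrix (Fin 2) (Fin 2) (ZMod p)) : act p F g (X 1) =
    cc p F (g 1 1) ^ 2 * cc p F (g 0 1) * X 0
      + (cc p F (g 1 1) ^ 2 * cc p F (g 0 0) + 2 * cc p F (g 1 1) * cc p F (g 0 1) * cc p F (g 1 0)) * X 1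
      + (2 * cc p F (g 1 1) * cc p F (g 1 0) * cc p F (g 0 0) + cc p F (g 0 1) * cc p F (g 1 0) ^ 2) * X 2
      + cc p F (g 1 0) ^ 2 * cc p F (g 0 0) * X 3 := by
  simp [act, cc]

lemma card_units_cc (f : MvPolynomial (Fin 4) F) : ∑ _u : (ZMod p)ˣ, f = - f := by
  have hp := (Fact.out : p.Prime).two_le
  rw [Finset.sum_const, Finset.card_univ, ZMod.card_units p, nsmul_eq_mul,
    Nat.cast_sub (by omega), CharP.cast_eq_zero]
  simp

lemma trG_eq : trG p F (X 1 ^ (p - 1)) = (∑ s : ZMod p, MM p F s ^ (p - 1)) + X 0 ^ (p - 1) := by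
  unfold trG
  rw [← (Equiv.ofBijective _ (cells_bij (p := p))).sum_comp, Fintype.sum_sum_type]
  simp only [Equiv.ofBijective_apply, Sum.elim_inl, Sum.elim_inr, Fintype.sum_prod_type]
  congr 1
  · have e : ∀ u : (ZMod p)ˣ, ∀ s : ZMod p, ∑ t : ZMod p,
        act p F (cell1 (u, s, t)).1 (X 1 ^ (p - 1)) = - MM p F s ^ (p - 1) := by
      intro u s
      have := sumlin (cc p F) (- (cc p F (u⁻¹ : (ZMod p)ˣ)) * (cc p F u ^ 2 *
        (cc p F s ^ 2 * X 0 + 2 * cc p F s * X 1 + X 2))) (cc p F u ^ 2 * MM p F s)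
      rw [mul_pow, ccu2, one_mul] at this
      rw [← this]
      refine Finset.sum_congr rfl fun t _ => ?_
      rw [map_pow]
      congr 1
      rw [act1]
      simp only [cell1, Matrix.of_apply, Matrix.cons_val', Matrix.cons_val_zero, Matrix.cons_val_one,
        Matrix.cons_val_fin_one, map_mul, map_sub, MM]
      ring
    simp only [e]
    rw [Finset.sum_comm]
    simp only [card_units_cc, neg_neg]
  · have e : ∀ u : (ZMod p)ˣ, ∑ t : ZMod p,
        act p F (cell2 (u, t)).1 (X 1 ^ (p - 1)) = - X 0 ^ (p - 1) := by
      intro u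
      have := sumlin (cc p F) (cc p F u ^ 2 * cc p F (u⁻¹ : (ZMod p)ˣ) * X 1) (cc p F u ^ 2 * X 0)
      rw [mul_pow, ccu2, one_mul] at this
      rw [← this]
      refine Finset.sum_congr rfl fun t _ => ?_
      rw [map_pow]
      congr 1
      rw [act1]
      simp only [cell2, Matrix.of_apply, Matrix.cons_val', Matrix.cons_val_zero, Matrix.cons_val_one,
        Matrix.cons_val_fin_one, map_zero]
      ring
    simp only [e]
    simp only [card_units_cc, neg_neg]

lemma K_eq : Kpoly p F = - (∑ s : ZMod p, MM p F s ^ (p - 1)) - X 0 ^ (p - 1) := by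
  rw [Kpoly, trG_eq]; ring

lemma three_pow (hp : 3 < p) : (3 : MvPolynomial (Fin 4) F) ^ (p - 1) = 1 := by
  have h3 : (3 : ZMod p) ≠ 0 := by
    intro h
    have : ((3 : ℕ) : ZMod p) = 0 := by exact_mod_cast h
    rw [ZMod.natCast_eq_zero_iff] at this
    have := Nat.le_of_dvd (by omega) this
    omega
  have := congrArg (cc p F) (ZMod.pow_card_sub_one_eq_one h3)
  simpa only [map_pow, map_ofNat, map_one] using this

lemma exists_half (hp : 3 < p) : ∃ h, p = 2 * h + 1 := by
  rcases (Fact.out : p.Prime).eq_two_or_odd with h | h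
  · omega
  · exact ⟨p / 2, by omega⟩

lemma K_mod (hp : 3 < p) :
    X 0 ∣ (Kpoly p F - ((3 * xipoly F) ^ ((p - 1) / 2) + X 1 ^ (p - 1))) := by
  obtain ⟨h, hh⟩ := exists_half p hp
  have q := quad h hh (cc p F) (3 * X 1) (3 * X 2) (X 3)
  have e : (3 * X 2 : MvPolynomial (Fin 4) F) ^ 2 - 4 * (3 * X 1) * X 3 = 3 * xipoly F := by
    rw [xipoly]; ring
  rw [e, mul_pow 3 (X 1), three_pow p F hp, one_mul] at q
  rw [show (p - 1) / 2 = h by omega]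
  have e2 : Kpoly p F - ((3 * xipoly F) ^ h + X 1 ^ (p - 1)) =
      - (∑ s : ZMod p, (MM p F s ^ (p - 1) -
        (3 * X 1 * cc p F s ^ 2 + 3 * X 2 * cc p F s + X 3) ^ (p - 1))) - X 0 ^ (p - 1) := by
    rw [K_eq, Finset.sum_sub_distrib, q]; ring
  rw [e2]
  refine dvd_sub ((Finset.dvd_sum fun s _ => ?_).neg_right) (dvd_pow_self _ (by omega))
  refine dvd_trans ?_ (sub_dvd_pow_sub_pow _ _ _)
  refine ⟨cc p F s ^ 3, ?_⟩
  rw [MM]; ring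

lemma xi_mod (hp : 3 < p) :
    (X 1 : MvPolynomial (Fin 4) F) ∣ (3 * xipoly F) ^ ((p - 1) / 2) + X 1 ^ (p - 1) - X 2 ^ (p - 1) := by
  obtain ⟨h, hh⟩ := exists_half p hp
  have e : (X 2 : MvPolynomial (Fin 4) F) ^ (p - 1) = ((3 * X 2) ^ 2) ^ h := by
    rw [← pow_mul, show 2 * h = p - 1 by omega, mul_pow, three_pow p F hp, one_mul]
  rw [show (p - 1) / 2 = h by omega, e, add_sub_right_comm]
  refine dvd_add (dvd_trans ?_ (sub_dvd_pow_sub_pow _ _ _)) (dvd_pow_self _ (by omega))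
  refine ⟨-12 * X 3, ?_⟩
  rw [xipoly]; ring

lemma K_hom : (Kpoly p F).IsHomogeneous (p - 1) := by
  have hM : ∀ s, (MM p F s).IsHomogeneous 1 := by
    intro s
    have : MM p F s = C (ZMod.castHom (dvd_refl p) F s ^ 3) * X 0
        + C (3 * ZMod.castHom (dvd_refl p) F s ^ 2) * X 1
        + C (3 * ZMod.castHom (dvd_refl p) F s) * X 2 + X 3 := by
      simp only [MM, cc, RingHom.comp_apply, C_mul, C_pow, map_ofNat]
    rw [this]
    exact (((isHomogeneous_C_mul_X _ _).add (isHomogeneous_C_mul_X _ _)).add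
      (isHomogeneous_C_mul_X _ _)).add (isHomogeneous_X _ _)
  rw [K_eq]
  refine (IsHomogeneous.neg ?_).sub (isHomogeneous_X_pow _ _)
  refine IsHomogeneous.sum _ _ _ fun s _ => ?_
  simpa using (hM s).pow (p - 1)

lemma K_coeff (hp : 3 < p) (e : Fin 4 →₀ ℕ) (h0 : e 0 = 0) (h1 : e 1 = 0) :
    coeff e (Kpoly p F) = if Finsupp.single 2 (p - 1) = e then 1 else 0 := by
  classical
  obtain ⟨U, hU⟩ := K_mod p F hp
  obtain ⟨V, hV⟩ := xi_mod p F hp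
  have : Kpoly p F = X 2 ^ (p - 1) + X 0 * U + X 1 * V := by
    linear_combination hU + hV
  rw [this, coeff_add, coeff_add, coeff_X_mul', coeff_X_mul', coeff_X_pow]
  simp [h0, h1]

end helpers

/-- `K = -tr^G(a₁^{p-1})` satisfies `K = -tr^P(a₃^{p-1}) - a₀^{p-1}` and
`K ≡ (3ξ)^{(p-1)/2} + a₁^{p-1}` modulo the ideal `(a₀)`, where `ξ = 3a₂² - 4a₃a₁`.
In particular `K ≠ 0` and its lead monomial (grevlex, `a₀ < a₁ < a₂ < a₃`) is `a₂^{p-1}`. -/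
theorem Klem (p : ℕ) [Fact p.Prime] (hp : 3 < p)
    (F : Type) [Field F] [CharP F p] :
    Kpoly p F = - trP p F (X 3 ^ (p - 1)) - X 0 ^ (p - 1) ∧
    X 0 ∣ (Kpoly p F - ((3 * xipoly F) ^ ((p - 1) / 2) + X 1 ^ (p - 1))) ∧
    Kpoly p F ≠ 0 ∧
    LeadMonomialIs (Kpoly p F) (Finsupp.single 2 (p - 1)) := by
  have hl : LeadMonomialIs (Kpoly p F) (Finsupp.single 2 (p - 1)) := by
    constructor
    · rw [K_coeff p F hp _ (by simp) (by simp)]; simp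
    · intro e he hne
      have he := mem_support_iff.1 he
      have hs : ∑ i : Fin 4, e i = p - 1 := by
        have := K_hom p F he
        rw [← this, Pi.one_def, ← Finsupp.degree_eq_weight_one]
        simp [Finsupp.degree_eq_sum]
      right
      refine ⟨by rw [hs]; simp only [Finsupp.single_apply, Fin.sum_univ_four]; simp, ?_⟩
      by_cases h0 : e 0 = 0
      · by_cases h1 : e 1 = 0
        · rw [K_coeff p F hp e h0 h1] at he
          exact absurd (if_neg hne.symm) he
        · refine ⟨1, by simp; omega, fun j hj => ?_⟩
          have : j = 0 := by omega
          subst this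
          simp [h0]
      · exact ⟨0, by simp; omega, fun j hj => by simp at hj⟩
  refine ⟨?_, K_mod p F hp, ?_, hl⟩
  · rw [K_eq, trP_eq]
  · intro h
    apply hl.1
    rw [h]; simp

end
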